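/- Let 𝒢 = (G, γ, (≺_i)_{1≤i≤h}) be an ordered level graph. For a separation s and a set U of edges of G each of which joins two vertices that are on s, let T(s, U) denote the assertion that there exists a nice sweeping sequence for 𝒢 that starts with (0, …, 0), ends with s, uses all edges in U, and uses all edges of G incident to at least one vertex to the left of s; additionally, T(s, ⊥) is declared false. Let s = (p_1, …, p_h) ≠ (0, …, 0). For each j ∈ [h] with p_j ≥ 1, let s_j′ = (p_1, …, p_{j−1}, p_j − 1, p_{j+1}, …, p_h), and define U_j′ as follows: if p_j represents a vertex v, then U_j′ = ⊥ in case U contains an edge joining v with a vertex on s that is neither the predecessor nor the successor of v on s, and otherwise U_j′ is U with the (at most two) edges of U incident to v removed; if p_j represents a gap, let v be the vertex represented by index p_j − 1 on level j; then U_j′ = ⊥ in case v is adjacent in G to a vertex to the right of s, and otherwise U_j′ is obtained from U by removing the edge joining the predecessor and the successor of v along s_j′ (if such an edge exists and lies in U) and adding all edges of G that join v with a vertex on s_j′. Then T(s, U) holds if and only if there exists j ∈ [h] with p_j ≥ 1 such that T(s_j′, U_j′) holds. -/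

import Mathlib

open scoped Classical

/-- A level graph: a finite directed graph with a surjective level assignment
`lvl : V → {1, …, h}` such that edges go strictly upwards. -/
structure OrderedLevelGraph (V : Type) [Fintype V] where
  h : ℕ
  Edge : V → V → Prop
  lvl : V → ℕ
  lvl_one_le : ∀ v, 1 ≤ lvl v
  lvl_le : ∀ v, lvl v ≤ h
  lvl_surj : ∀ i, 1 ≤ i → i ≤ h → ∃ v, lvl v = i
  edge_lt : ∀ u v, Edge u v → lvl u < lvl v
  /-- the total order `≺ᵢ` on each level -/
  prec : ℕ → V → V → Prop
  prec_lvl : ∀ i u v, prec i u v → lvl u = i ∧ lvl v = i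
  prec_irrefl : ∀ i v, ¬ prec i v v
  prec_trans : ∀ i a b c, prec i a b → prec i b c → prec i a c
  prec_total : ∀ i u v, lvl u = i → lvl v = i → u ≠ v → prec i u v ∨ prec i v u

/-- An ordered level planar drawing: x-coordinates for the vertices, a y-monotone
curve (given by its x-coordinate `f u v t` at height `t`) for every edge, no
crossings, edges pass through no non-incident vertices, and the left-to-right
order on each level agrees with `≺ᵢ`. -/
structure OLPDrawing {V : Type} [Fintype V] (G : OrderedLevelGraph V) where
  x : V → ℝ
  f : V → V → ℝ → ℝ
  x_inj : ∀ u v, G.lvl u = G.lvl v → x u = x v → u = v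
  f_cont : ∀ u v, G.Edge u v → ContinuousOn (f u v) (Set.Icc (G.lvl u : ℝ) (G.lvl v : ℝ))
  f_src : ∀ u v, G.Edge u v → f u v (G.lvl u : ℝ) = x u
  f_tgt : ∀ u v, G.Edge u v → f u v (G.lvl v : ℝ) = x v
  planar : ∀ u v u' v', G.Edge u v → G.Edge u' v' → (u, v) ≠ (u', v') →
    ∀ t : ℝ, t ∈ Set.Icc (G.lvl u : ℝ) (G.lvl v : ℝ) →
      t ∈ Set.Icc (G.lvl u' : ℝ) (G.lvl v' : ℝ) → f u v t = f u' v' t →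
      ∃ w, (w = u ∨ w = v) ∧ (w = u' ∨ w = v') ∧ t = (G.lvl w : ℝ) ∧ f u v t = x w
  no_through : ∀ u v w, G.Edge u v → w ≠ u → w ≠ v →
    G.lvl u ≤ G.lvl w → G.lvl w ≤ G.lvl v → f u v (G.lvl w : ℝ) ≠ x w
  prec_ok : ∀ i u v, G.prec i u v → x u < x v

variable {V : Type} [Fintype V]

/-- `λᵢ`, the number of vertices on level `i`. -/
noncomputable def lam (G : OrderedLevelGraph V) (i : ℕ) : ℕ := Nat.card {v : V // G.lvl v = i}

/-- The (odd) position index representing vertex `v` on its level: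
`2·rank(v) + 1`, where `rank v` is the number of vertices preceding `v`
in the total order of its level. -/
noncomputable def idx (G : OrderedLevelGraph V) (v : V) : ℕ :=
  2 * Nat.card {u : V // G.prec (G.lvl v) u v} + 1

/-- A separation: a choice of a position index on every level. -/
def IsSep (G : OrderedLevelGraph V) (s : ℕ → ℕ) : Prop := ∀ i, s i ≤ 2 * lam G i

/-- Vertex `v` is on the separation `s`. -/
def OnSep (G : OrderedLevelGraph V) (s : ℕ → ℕ) (v : V) : Prop := s (G.lvl v) = idx G v

/-- `u` and `v` (with `lvl u < lvl v`) are consecutive on `s`: both are on `s`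
and all intermediate levels carry a gap (an even index). -/
def ConsecOn (G : OrderedLevelGraph V) (s : ℕ → ℕ) (u v : V) : Prop :=
  OnSep G s u ∧ OnSep G s v ∧ G.lvl u < G.lvl v ∧
    ∀ j, G.lvl u < j → j < G.lvl v → s j % 2 = 0

/-- The separation `s` uses the edge `(u, v)`. -/
def UsesEdge (G : OrderedLevelGraph V) (s : ℕ → ℕ) (u v : V) : Prop :=
  G.Edge u v ∧ ConsecOn G s u v

/-- A sweeping sequence: a finite sequence of separations that is
componentwise nondecreasing. -/
def IsSweep (G : OrderedLevelGraph V) (S : List (ℕ → ℕ)) : Prop :=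
  (∀ s ∈ S, IsSep G s) ∧ S.Chain' fun s s' => ∀ i, s i ≤ s' i

/-- A sequence of separations is nice if each member arises from its
predecessor by incrementing exactly one component by 1. -/
def IsNice (S : List (ℕ → ℕ)) : Prop :=
  S.Chain' fun s s' => ∃ j, s' j = s j + 1 ∧ ∀ i, i ≠ j → s' i = s i

/-- Vertex `v` lies to the left of the separation `s`. -/
def LeftOf (G : OrderedLevelGraph V) (s : ℕ → ℕ) (v : V) : Prop :=
  idx G v < s (G.lvl v)

/-- Vertex `v` lies to the right of the separation `s`. -/
def RightOf (G : OrderedLevelGraph V) (s : ℕ → ℕ) (v : V) : Prop :=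
  s (G.lvl v) < idx G v

/-- The dynamic-programming predicate `T(s, U)`: there is a nice sweeping
sequence starting at `(0, …, 0)`, ending at `s`, using all edges of `U` and
all edges incident to a vertex to the left of `s`.  `T(s, ⊥)` is false. -/
def T (G : OrderedLevelGraph V) (s : ℕ → ℕ) (U : Option (Finset (V × V))) : Prop :=
  match U with
  | none => False
  | some U =>
      ∃ S : List (ℕ → ℕ), IsSweep G S ∧ IsNice S ∧
        (∀ s0 ∈ S.head?, ∀ i, s0 i = 0) ∧ S.getLast? = some s ∧
        (∀ e ∈ U, ∃ s' ∈ S, UsesEdge G s' e.1 e.2) ∧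
        (∀ u v, G.Edge u v → (LeftOf G s u ∨ LeftOf G s v) →
          ∃ s' ∈ S, UsesEdge G s' u v)

/-- The separation `s_j'` obtained from `s` by decrementing component `j`. -/
def sj (s : ℕ → ℕ) (j : ℕ) : ℕ → ℕ := Function.update s j (s j - 1)

/-- The edge set `U_j'` of the recurrence (where `none` encodes `⊥`). -/
noncomputable def Uj (G : OrderedLevelGraph V) (s : ℕ → ℕ) (U : Finset (V × V))
    (j : ℕ) : Option (Finset (V × V)) :=
  if s j % 2 = 1 then
    -- `p_j` represents a vertex `v`
    if hv : ∃ v, G.lvl v = j ∧ idx G v = s j then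
      let v := hv.choose
      if ∃ e ∈ U, ∃ w, ((e.1 = v ∧ e.2 = w) ∨ (e.2 = v ∧ e.1 = w)) ∧ OnSep G s w ∧
            ¬ ConsecOn G s w v ∧ ¬ ConsecOn G s v w then
        none
      else
        some (U.filter fun e => e.1 ≠ v ∧ e.2 ≠ v)
    else none
  else
    -- `p_j` represents a gap, so `p_j - 1` represents a vertex `v`
    if hv : ∃ v, G.lvl v = j ∧ idx G v = s j - 1 then
      let v := hv.choose
      if ∃ w, (G.Edge v w ∨ G.Edge w v) ∧ RightOf G s w then
        none
      else
        some ((U.filter fun e =>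
            ¬ (ConsecOn G (sj s j) e.1 v ∧ ConsecOn G (sj s j) v e.2)) ∪
          Finset.univ.filter fun e : V × V =>
            (e.1 = v ∧ G.Edge v e.2 ∧ OnSep G (sj s j) e.2) ∨
            (e.2 = v ∧ G.Edge e.1 v ∧ OnSep G (sj s j) e.1))
    else none

/-- The number of vertices preceding `v` on its level is strictly monotone along the level. -/
theorem idx_lt_idx (G : OrderedLevelGraph V) {u v : V} (h : G.prec (G.lvl v) u v) :
    idx G u < idx G v := by
  have hl := (G.prec_lvl _ _ _ h).1
  have hlt : Nat.card {w : V // G.prec (G.lvl u) w u} <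
      Nat.card {w : V // G.prec (G.lvl v) w v} := by
    have hss : {w : V | G.prec (G.lvl u) w u} ⊂ {w : V | G.prec (G.lvl v) w v} := by
      refine ⟨fun w hw => ?_, fun hsub => ?_⟩
      · rw [Set.mem_ofPred_eq, hl] at hw
        exact G.prec_trans _ _ _ _ hw h
      · exact G.prec_irrefl _ u (hsub h)
    exact Set.ncard_lt_ncard hss (Set.toFinite _)
  unfold idx
  omega

theorem idx_inj (G : OrderedLevelGraph V) {u v : V} (hl : G.lvl u = G.lvl v)
    (hi : idx G u = idx G v) : u = v := by
  by_contra hne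
  rcases G.prec_total (G.lvl v) u v hl rfl hne with h | h
  · exact (idx_lt_idx G h).ne hi
  · rw [← hl] at h
    exact (idx_lt_idx G h).ne hi.symm

theorem idx_mod_two (G : OrderedLevelGraph V) (v : V) : idx G v % 2 = 1 := by
  unfold idx
  omega

theorem idx_lt_two_mul_lam (G : OrderedLevelGraph V) (v : V) :
    idx G v < 2 * lam G (G.lvl v) := by
  have hss : {w : V | G.prec (G.lvl v) w v} ⊂ {w : V | G.lvl w = G.lvl v} :=
    ⟨fun w hw => (G.prec_lvl _ _ _ hw).1, fun hsub => G.prec_irrefl _ v (hsub rfl)⟩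
  have hlt : Nat.card {w : V // G.prec (G.lvl v) w v} < Nat.card {w : V // G.lvl w = G.lvl v} :=
    Set.ncard_lt_ncard hss (Set.toFinite _)
  unfold idx lam
  omega

/-- Every odd position index represents a vertex. -/
theorem exists_idx_eq (G : OrderedLevelGraph V) {i n : ℕ} (hn : n % 2 = 1)
    (hle : n ≤ 2 * lam G i) : ∃ v, G.lvl v = i ∧ idx G v = n := by
  have hlt (v : {v : V // G.lvl v = i}) : idx G v.1 / 2 < lam G i := by
    have := idx_lt_two_mul_lam G v.1
    rw [v.2] at this
    omega
  let f : {v : V // G.lvl v = i} → Fin (lam G i) := fun v => ⟨idx G v.1 / 2, hlt v⟩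
  have hf : Function.Injective f := by
    intro a b hab
    have h : idx G a.1 / 2 = idx G b.1 / 2 := congrArg Fin.val hab
    have ha := idx_mod_two G a.1
    have hb := idx_mod_two G b.1
    exact Subtype.ext (idx_inj G (a.2.trans b.2.symm) (by omega))
  have hbij : Function.Bijective f :=
    (Fintype.bijective_iff_injective_and_card f).2 ⟨hf, by simp [lam, Nat.card_eq_fintype_card]⟩
  obtain ⟨v, hv⟩ := hbij.2 ⟨n / 2, by omega⟩
  have h : idx G v.1 / 2 = n / 2 := congrArg Fin.val hv
  have := idx_mod_two G v.1
  exact ⟨v.1, v.2, by omega⟩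

/-- `S` is a nice sweeping sequence from `(0, …, 0)` to `s`. -/
def IsNiceSweepTo (G : OrderedLevelGraph V) (s : ℕ → ℕ) (S : List (ℕ → ℕ)) : Prop :=
  IsSweep G S ∧ IsNice S ∧ (∀ s0 ∈ S.head?, ∀ i, s0 i = 0) ∧ S.getLast? = some s

theorem T_some_iff (G : OrderedLevelGraph V) (s : ℕ → ℕ) (U : Finset (V × V)) :
    T G s (some U) ↔ ∃ S, IsNiceSweepTo G s S ∧
      (∀ e ∈ U, ∃ s' ∈ S, UsesEdge G s' e.1 e.2) ∧
      (∀ u v, G.Edge u v → (LeftOf G s u ∨ LeftOf G s v) → ∃ s' ∈ S, UsesEdge G s' u v) := by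
  simp only [T, IsNiceSweepTo, and_assoc]

theorem sj_self (s : ℕ → ℕ) (j : ℕ) : sj s j j = s j - 1 := by
  simp [sj]

theorem sj_of_ne (s : ℕ → ℕ) {i j : ℕ} (h : i ≠ j) : sj s j i = s i := by
  simp [sj, h]

theorem sj_le (s : ℕ → ℕ) (i j : ℕ) : sj s j i ≤ s i := by
  by_cases h : i = j
  · subst h
    rw [sj_self]
    omega
  · rw [sj_of_ne s h]

theorem IsNiceSweepTo.le {G : OrderedLevelGraph V} {s : ℕ → ℕ} {S : List (ℕ → ℕ)}
    (h : IsNiceSweepTo G s S) {t : ℕ → ℕ} (ht : t ∈ S) (i : ℕ) : t i ≤ s i := by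
  obtain ⟨⟨-, hc⟩, -, -, hlast⟩ := h
  obtain ⟨L, rfl⟩ := List.getLast?_eq_some_iff.1 hlast
  have : IsTrans (ℕ → ℕ) fun a b => ∀ i, a i ≤ b i := ⟨fun a b c h1 h2 i => (h1 i).trans (h2 i)⟩
  have hp := List.isChain_iff_pairwise.1 hc
  rcases List.mem_append.1 ht with h | h
  · exact (List.pairwise_append.1 hp).2.2 t h s (by simp) i
  · rw [List.mem_singleton.1 h]

theorem IsNiceSweepTo.append {G : OrderedLevelGraph V} {s : ℕ → ℕ} {S : List (ℕ → ℕ)} {j : ℕ}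
    (hs : IsSep G s) (hj : 1 ≤ s j) (h : IsNiceSweepTo G (sj s j) S) :
    IsNiceSweepTo G s (S ++ [s]) := by
  obtain ⟨⟨hsep, hc⟩, hn, hh, hlast⟩ := h
  refine ⟨⟨?_, ?_⟩, ?_, ?_, by simp⟩
  · intro t ht
    rcases List.mem_append.1 ht with h | h
    · exact hsep t h
    · rwa [List.mem_singleton.1 h]
  · refine List.isChain_append.2 ⟨hc, by simp, ?_⟩
    intro x hx y hy i
    rw [hlast] at hx
    simp only [Option.mem_def, Option.some.injEq, List.head?_cons] at hx hy
    subst hx hy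
    exact sj_le _ _ _
  · refine List.isChain_append.2 ⟨hn, by simp, ?_⟩
    intro x hx y hy
    rw [hlast] at hx
    simp only [Option.mem_def, Option.some.injEq, List.head?_cons] at hx hy
    subst hx hy
    refine ⟨j, ?_, fun i hi => (sj_of_ne _ hi).symm⟩
    rw [sj_self]
    omega
  · intro t ht
    obtain ⟨L, rfl⟩ := List.getLast?_eq_some_iff.1 hlast
    refine hh t ?_
    cases L <;> simpa using ht

theorem IsNiceSweepTo.exists_prev {G : OrderedLevelGraph V} {s : ℕ → ℕ} {S : List (ℕ → ℕ)}
    (hnz : ∃ i, s i ≠ 0) (h : IsNiceSweepTo G s S) :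
    ∃ j S', 1 ≤ s j ∧ IsNiceSweepTo G (sj s j) S' ∧ S = S' ++ [s] := by
  obtain ⟨⟨hsep, hc⟩, hn, hh, hlast⟩ := h
  obtain ⟨S', rfl⟩ := List.getLast?_eq_some_iff.1 hlast
  rcases List.eq_nil_or_concat S' with rfl | ⟨L, t, rfl⟩
  · obtain ⟨i, hi⟩ := hnz
    exact absurd (hh s (by simp) i) hi
  · rw [List.concat_eq_append] at *
    obtain ⟨hn1, -, hn2⟩ := List.isChain_append.1 hn
    obtain ⟨j, hj, hne⟩ := hn2 t (by simp) s (by simp)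
    have ht : sj s j = t := by
      funext i
      by_cases h : i = j
      · subst h
        rw [sj_self]
        omega
      · rw [sj_of_ne s h, hne i h]
    refine ⟨j, L ++ [t], by omega, ⟨⟨?_, (List.isChain_append.1 hc).1⟩, hn1, ?_, ?_⟩, rfl⟩
    · exact fun x hx => hsep x (List.mem_append_left _ hx)
    · intro x hx
      refine hh x ?_
      cases L <;> simpa using hx
    · simp [ht]

theorem LeftOf.not_onSep {G : OrderedLevelGraph V} {s : ℕ → ℕ} {v : V} (h : LeftOf G s v) :
    ¬ OnSep G s v := by
  unfold LeftOf OnSep at *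
  omega

theorem LeftOf.of_sj {G : OrderedLevelGraph V} {s : ℕ → ℕ} {j : ℕ} {v : V}
    (h : LeftOf G (sj s j) v) : LeftOf G s v :=
  lt_of_lt_of_le h (sj_le _ _ _)

/-- A vertex to the left of `s` is to the left of `sj s j`, unless it is represented by the
index `s j - 1` on level `j`. -/
theorem LeftOf.sj_or_eq {G : OrderedLevelGraph V} {s : ℕ → ℕ} (j : ℕ) {v : V}
    (h : LeftOf G s v) : LeftOf G (sj s j) v ∨ G.lvl v = j ∧ idx G v = s j - 1 := by
  unfold LeftOf at *
  by_cases hv : G.lvl v = j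
  · subst hv
    rw [sj_self]
    omega
  · rw [sj_of_ne s hv]
    exact Or.inl h

theorem onSep_sj_iff {G : OrderedLevelGraph V} {s : ℕ → ℕ} {j : ℕ} {v : V}
    (h : G.lvl v ≠ j) : OnSep G (sj s j) v ↔ OnSep G s v := by
  unfold OnSep
  rw [sj_of_ne s h]

/-- Changing a level outside of the interval between `u` and `v`, or keeping the index
on it even, does not affect consecutiveness of `u` and `v`. -/
theorem ConsecOn.sj {G : OrderedLevelGraph V} {s : ℕ → ℕ} {j : ℕ} {u v : V}
    (h : ConsecOn G s u v) (hu : G.lvl u ≠ j) (hv : G.lvl v ≠ j)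
    (hj : G.lvl u < j → j < G.lvl v → sj s j j % 2 = 0) : ConsecOn G (sj s j) u v := by
  obtain ⟨h1, h2, h3, h4⟩ := h
  refine ⟨(onSep_sj_iff hu).2 h1, (onSep_sj_iff hv).2 h2, h3, fun k hk1 hk2 => ?_⟩
  by_cases hk : k = j
  · subst hk
    exact hj hk1 hk2
  · rw [sj_of_ne s hk]
    exact h4 k hk1 hk2

theorem Uj_of_vertex (G : OrderedLevelGraph V) (s : ℕ → ℕ) (U : Finset (V × V)) {v : V}
    (hv : idx G v = s (G.lvl v)) :
    Uj G s U (G.lvl v) =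
      if ∃ e ∈ U, ∃ w, ((e.1 = v ∧ e.2 = w) ∨ (e.2 = v ∧ e.1 = w)) ∧ OnSep G s w ∧
            ¬ ConsecOn G s w v ∧ ¬ ConsecOn G s v w then
        none
      else
        some (U.filter fun e => e.1 ≠ v ∧ e.2 ≠ v) := by
  have hex : ∃ w, G.lvl w = G.lvl v ∧ idx G w = s (G.lvl v) := ⟨v, rfl, hv⟩
  have hc : hex.choose = v :=
    idx_inj G hex.choose_spec.1 (hex.choose_spec.2.trans hv.symm)
  have hodd : s (G.lvl v) % 2 = 1 := hv ▸ idx_mod_two G v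
  unfold Uj
  rw [if_pos hodd, dif_pos hex]
  simp only [hc]

theorem Uj_of_gap (G : OrderedLevelGraph V) (s : ℕ → ℕ) (U : Finset (V × V)) {v : V}
    (hv : s (G.lvl v) = idx G v + 1) :
    Uj G s U (G.lvl v) =
      if ∃ w, (G.Edge v w ∨ G.Edge w v) ∧ RightOf G s w then
        none
      else
        some ((U.filter fun e =>
            ¬ (ConsecOn G (sj s (G.lvl v)) e.1 v ∧ ConsecOn G (sj s (G.lvl v)) v e.2)) ∪
          Finset.univ.filter fun e : V × V =>
            (e.1 = v ∧ G.Edge v e.2 ∧ OnSep G (sj s (G.lvl v)) e.2) ∨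
            (e.2 = v ∧ G.Edge e.1 v ∧ OnSep G (sj s (G.lvl v)) e.1)) := by
  have hex : ∃ w, G.lvl w = G.lvl v ∧ idx G w = s (G.lvl v) - 1 := ⟨v, rfl, by omega⟩
  have hc : hex.choose = v :=
    idx_inj G hex.choose_spec.1 (by have := hex.choose_spec.2; omega)
  have hodd : ¬ s (G.lvl v) % 2 = 1 := by
    have := idx_mod_two G v
    omega
  unfold Uj
  rw [if_neg hodd, dif_pos hex]
  simp only [hc]

/-- A positive component of a separation represents a vertex, or a gap following a vertex. -/
theorem IsSep.exists_vertex {G : OrderedLevelGraph V} {s : ℕ → ℕ} (hs : IsSep G s) {j : ℕ}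
    (hj : 1 ≤ s j) : ∃ v, G.lvl v = j ∧ (idx G v = s j ∨ s j = idx G v + 1) := by
  have hle := hs j
  rcases Nat.mod_two_eq_zero_or_one (s j) with h | h
  · obtain ⟨v, hl, hv⟩ := exists_idx_eq G (n := s j - 1) (by omega) (hle.trans' (Nat.sub_le _ _))
    exact ⟨v, hl, Or.inr (by omega)⟩
  · obtain ⟨v, hl, hv⟩ := exists_idx_eq G h hle
    exact ⟨v, hl, Or.inl hv⟩

/-- An edge used by `S ++ [s]` but not by `s` is used by `S`. -/
theorem exists_usesEdge_of_append {G : OrderedLevelGraph V} {s : ℕ → ℕ} {S : List (ℕ → ℕ)}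
    {u v : V} (h : ∃ t ∈ S ++ [s], UsesEdge G t u v)
    (hs : UsesEdge G s u v → ∃ t ∈ S, UsesEdge G t u v) : ∃ t ∈ S, UsesEdge G t u v := by
  obtain ⟨t, ht, hu⟩ := h
  rcases List.mem_append.1 ht with h | h
  · exact ⟨t, h, hu⟩
  · rw [List.mem_singleton.1 h] at hu
    exact hs hu

theorem exists_usesEdge_append {G : OrderedLevelGraph V} {S : List (ℕ → ℕ)}
    {u v : V} (s : ℕ → ℕ) (h : ∃ t ∈ S, UsesEdge G t u v) :
    ∃ t ∈ S ++ [s], UsesEdge G t u v := by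
  obtain ⟨t, ht, hu⟩ := h
  exact ⟨t, List.mem_append_left _ ht, hu⟩

theorem not_right_of_used {G : OrderedLevelGraph V} {s t : ℕ → ℕ} (hle : ∀ i, t i ≤ s i)
    {w : V} (hw : OnSep G t w) : ¬ RightOf G s w := by
  have := hle (G.lvl w)
  unfold OnSep RightOf at *
  omega

/-- Removing the last step of a sweeping sequence, when it moves onto the vertex `v`. -/
theorem T_sj_of_vertex {G : OrderedLevelGraph V} {s : ℕ → ℕ} {U : Finset (V × V)} {v : V}
    {S : List (ℕ → ℕ)} (hv : idx G v = s (G.lvl v))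
    (hS : IsNiceSweepTo G (sj s (G.lvl v)) S)
    (hU : ∀ e ∈ U, ∃ t ∈ S ++ [s], UsesEdge G t e.1 e.2)
    (hL : ∀ u w, G.Edge u w → (LeftOf G s u ∨ LeftOf G s w) →
      ∃ t ∈ S ++ [s], UsesEdge G t u w) :
    T G (sj s (G.lvl v)) (Uj G s U (G.lvl v)) := by
  have hodd := idx_mod_two G v
  have hnot (t : ℕ → ℕ) (ht : t ∈ S) : ¬ OnSep G t v := by
    have := hS.le ht (G.lvl v)
    rw [sj_self] at this
    unfold OnSep
    omega
  have hlast : sj s (G.lvl v) ∈ S := List.mem_of_getLast? hS.2.2.2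
  have hconsec (e : V × V) (he : e ∈ U) (hev : e.1 = v ∨ e.2 = v) : ConsecOn G s e.1 e.2 := by
    obtain ⟨t, ht, hu⟩ := hU e he
    rcases List.mem_append.1 ht with h | h
    · rcases hev with hev | hev
      · exact absurd (hev ▸ hu.2.1) (hnot t h)
      · exact absurd (hev ▸ hu.2.2.1) (hnot t h)
    · rw [List.mem_singleton.1 h] at hu
      exact hu.2
  rw [Uj_of_vertex G s U hv, if_neg, T_some_iff]
  · refine ⟨S, hS, fun e he => ?_, fun u w huw hlr => ?_⟩
    · obtain ⟨heU, h1, h2⟩ := Finset.mem_filter.1 he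
      refine exists_usesEdge_of_append (hU e heU) fun hu => ⟨_, hlast, hu.1, ?_⟩
      have hne {x : V} (hx : OnSep G s x) (hxv : x ≠ v) : G.lvl x ≠ G.lvl v := fun hl =>
        hxv (idx_inj G hl (by rw [hv, ← hl]; exact hx.symm))
      refine hu.2.sj (hne hu.2.1 h1) (hne hu.2.2.1 h2) fun _ _ => ?_
      rw [sj_self]
      omega
    · have hlr' := hlr.imp LeftOf.of_sj LeftOf.of_sj
      refine exists_usesEdge_of_append (hL u w huw hlr') fun hu => ?_
      exact (hlr'.elim (fun h => h.not_onSep hu.2.1) (fun h => h.not_onSep hu.2.2.1)).elim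
  · rintro ⟨e, he, w, ⟨h1, h2⟩ | ⟨h1, h2⟩, -, hwv, hvw⟩
    · exact hvw (h1 ▸ h2 ▸ hconsec e he (Or.inl h1))
    · exact hwv (h1 ▸ h2 ▸ hconsec e he (Or.inr h1))

/-- Removing the last step of a sweeping sequence, when it moves off the vertex `v`. -/
theorem T_sj_of_gap {G : OrderedLevelGraph V} {s : ℕ → ℕ} {U : Finset (V × V)} {v : V}
    {S : List (ℕ → ℕ)} (hv : s (G.lvl v) = idx G v + 1)
    (hS : IsNiceSweepTo G (sj s (G.lvl v)) S)
    (hU : ∀ e ∈ U, ∃ t ∈ S ++ [s], UsesEdge G t e.1 e.2)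
    (hL : ∀ u w, G.Edge u w → (LeftOf G s u ∨ LeftOf G s w) →
      ∃ t ∈ S ++ [s], UsesEdge G t u w) :
    T G (sj s (G.lvl v)) (Uj G s U (G.lvl v)) := by
  have hodd := idx_mod_two G v
  have hvL : LeftOf G s v := by
    unfold LeftOf
    omega
  have hvon : OnSep G (sj s (G.lvl v)) v := by
    unfold OnSep
    rw [sj_self]
    omega
  have hle (t : ℕ → ℕ) (ht : t ∈ S ++ [s]) (i : ℕ) : t i ≤ s i := by
    rcases List.mem_append.1 ht with h | h
    · exact (hS.le h i).trans (sj_le _ _ _)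
    · rw [List.mem_singleton.1 h]
  have hlast : sj s (G.lvl v) ∈ S := List.mem_of_getLast? hS.2.2.2
  have hleft (u w : V) (huw : G.Edge u w) (hlr : LeftOf G s u ∨ LeftOf G s w) :
      ∃ t ∈ S, UsesEdge G t u w :=
    exists_usesEdge_of_append (hL u w huw hlr) fun hu =>
      (hlr.elim (fun h => h.not_onSep hu.2.1) (fun h => h.not_onSep hu.2.2.1)).elim
  rw [Uj_of_gap G s U hv, if_neg, T_some_iff]
  · refine ⟨S, hS, fun e he => ?_, fun u w huw hlr => ?_⟩
    · rcases Finset.mem_union.1 he with he | he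
      · obtain ⟨heU, hrem⟩ := Finset.mem_filter.1 he
        refine exists_usesEdge_of_append (hU e heU) fun hu => ⟨_, hlast, hu.1, ?_⟩
        have hne {x : V} (hx : OnSep G s x) : G.lvl x ≠ G.lvl v := fun hl => by
          have := idx_mod_two G x
          unfold OnSep at hx
          rw [hl] at hx
          omega
        have h1 := hne hu.2.1
        have h2 := hne hu.2.2.1
        refine hu.2.sj h1 h2 fun hlt1 hlt2 => (hrem ⟨?_, ?_⟩).elim
        · refine ⟨(onSep_sj_iff h1).2 hu.2.1, hvon, hlt1, fun k hk1 hk2 => ?_⟩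
          rw [sj_of_ne s hk2.ne]
          exact hu.2.2.2.2 k hk1 (hk2.trans hlt2)
        · refine ⟨hvon, (onSep_sj_iff h2).2 hu.2.2.1, hlt2, fun k hk1 hk2 => ?_⟩
          rw [sj_of_ne s hk1.ne']
          exact hu.2.2.2.2 k (hlt1.trans hk1) hk2
      · rcases (Finset.mem_filter.1 he).2 with ⟨h1, h2, -⟩ | ⟨h1, h2, -⟩
        · exact hleft _ _ (h1 ▸ h2) (Or.inl (h1 ▸ hvL))
        · exact hleft _ _ (h1 ▸ h2) (Or.inr (h1 ▸ hvL))
    · exact hleft u w huw (hlr.imp LeftOf.of_sj LeftOf.of_sj)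
  · rintro ⟨w, hw | hw, hr⟩
    · obtain ⟨t, ht, hu⟩ := hL v w hw (Or.inl hvL)
      exact not_right_of_used (hle t ht) hu.2.2.1 hr
    · obtain ⟨t, ht, hu⟩ := hL w v hw (Or.inr hvL)
      exact not_right_of_used (hle t ht) hu.2.1 hr

/-- Extending a sweeping sequence by a step that moves onto the vertex `v`. -/
theorem T_of_sj_vertex {G : OrderedLevelGraph V} {s : ℕ → ℕ} (hs : IsSep G s)
    {U : Finset (V × V)} (hU : ∀ e ∈ U, G.Edge e.1 e.2 ∧ OnSep G s e.1 ∧ OnSep G s e.2)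
    {v : V} (hv : idx G v = s (G.lvl v)) (h : T G (sj s (G.lvl v)) (Uj G s U (G.lvl v))) :
    T G s (some U) := by
  have hodd := idx_mod_two G v
  rw [Uj_of_vertex G s U hv] at h
  split_ifs at h with hbad
  · exact h.elim
  obtain ⟨S, hS, hSU, hSL⟩ := (T_some_iff _ _ _).1 h
  refine (T_some_iff _ _ _).2
    ⟨S ++ [s], hS.append hs (by omega), fun e he => ?_, fun u w huw hlr => ?_⟩
  · obtain ⟨hedge, h1, h2⟩ := hU e he
    have hlt := G.edge_lt _ _ hedge
    by_cases hinc : e.1 ≠ v ∧ e.2 ≠ v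
    · exact exists_usesEdge_append s (hSU e (Finset.mem_filter.2 ⟨he, hinc⟩))
    · refine ⟨s, by simp, hedge, ?_⟩
      by_contra hc
      rw [not_and_or, not_not, not_not] at hinc
      rcases hinc with hev | hev
      · exact hbad ⟨e, he, e.2, Or.inl ⟨hev, rfl⟩, h2,
          fun hx => hlt.not_gt (hev ▸ hx.2.2.1), hev ▸ hc⟩
      · exact hbad ⟨e, he, e.1, Or.inr ⟨hev, rfl⟩, h1,
          hev ▸ hc, fun hx => hlt.not_gt (hev ▸ hx.2.2.1)⟩
  · have hmono {x : V} (hx : LeftOf G s x) : LeftOf G (sj s (G.lvl v)) x :=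
      (hx.sj_or_eq (G.lvl v)).resolve_right fun hx' => by
        have := idx_mod_two G x
        omega
    exact exists_usesEdge_append s (hSL u w huw (hlr.imp hmono hmono))

/-- Extending a sweeping sequence by a step that moves off the vertex `v`. -/
theorem T_of_sj_gap {G : OrderedLevelGraph V} {s : ℕ → ℕ} (hs : IsSep G s)
    {U : Finset (V × V)} (hU : ∀ e ∈ U, G.Edge e.1 e.2 ∧ OnSep G s e.1 ∧ OnSep G s e.2)
    {v : V} (hv : s (G.lvl v) = idx G v + 1) (h : T G (sj s (G.lvl v)) (Uj G s U (G.lvl v))) :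
    T G s (some U) := by
  have hodd := idx_mod_two G v
  rw [Uj_of_gap G s U hv] at h
  split_ifs at h with hbad
  · exact h.elim
  obtain ⟨S, hS, hSU, hSL⟩ := (T_some_iff _ _ _).1 h
  have heq {x : V} (hx : G.lvl x = G.lvl v ∧ idx G x = s (G.lvl v) - 1) : x = v :=
    idx_inj G hx.1 (by omega)
  have hlevel {x : V} (hx : OnSep G s x) : G.lvl x ≠ G.lvl v := fun hl => by
    have := idx_mod_two G x
    unfold OnSep at hx
    rw [hl] at hx
    omega
  have hnbr {x : V} (hx : G.Edge v x ∨ G.Edge x v) :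
      LeftOf G (sj s (G.lvl v)) x ∨ OnSep G (sj s (G.lvl v)) x := by
    rcases lt_trichotomy (idx G x) (s (G.lvl x)) with hlt | he | hgt
    · refine (LeftOf.sj_or_eq (G.lvl v) hlt).imp_right fun hx' => ?_
      rw [heq hx'] at hx
      exact (hx.elim (G.edge_lt _ _) (G.edge_lt _ _)).ne rfl |>.elim
    · exact Or.inr ((onSep_sj_iff (hlevel he.symm)).2 he.symm)
    · exact (hbad ⟨x, hx, hgt⟩).elim
  refine (T_some_iff _ _ _).2
    ⟨S ++ [s], hS.append hs (by omega), fun e he => ?_, fun u w huw hlr => ?_⟩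
  · obtain ⟨hedge, h1, h2⟩ := hU e he
    by_cases hrem : ConsecOn G (sj s (G.lvl v)) e.1 v ∧ ConsecOn G (sj s (G.lvl v)) v e.2
    · refine ⟨s, by simp, hedge, h1, h2, G.edge_lt _ _ hedge, fun k hk1 hk2 => ?_⟩
      rcases lt_trichotomy k (G.lvl v) with hk | hk | hk
      · rw [← sj_of_ne s hk.ne]
        exact hrem.1.2.2.2 k hk1 hk
      · rw [hk]
        omega
      · rw [← sj_of_ne s hk.ne']
        exact hrem.2.2.2.2 k hk hk2
    · exact exists_usesEdge_append s
        (hSU e (Finset.mem_union_left _ (Finset.mem_filter.2 ⟨he, hrem⟩)))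
  · refine exists_usesEdge_append s ?_
    have hadd (hvx : u = v ∨ w = v) : ∃ t ∈ S, UsesEdge G t u w := by
      rcases hvx with rfl | rfl
      · rcases hnbr (Or.inl huw) with hx | hx
        · exact hSL _ _ huw (Or.inr hx)
        · exact hSU (u, w) (Finset.mem_union_right _
            (Finset.mem_filter.2 ⟨Finset.mem_univ _, Or.inl ⟨rfl, huw, hx⟩⟩))
      · rcases hnbr (Or.inr huw) with hx | hx
        · exact hSL _ _ huw (Or.inl hx)
        · exact hSU (u, w) (Finset.mem_union_right _
            (Finset.mem_filter.2 ⟨Finset.mem_univ _, Or.inr ⟨rfl, huw, hx⟩⟩))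
    rcases hlr with hl | hl
    · rcases hl.sj_or_eq (G.lvl v) with hx | hx
      · exact hSL _ _ huw (Or.inl hx)
      · exact hadd (Or.inl (heq hx))
    · rcases hl.sj_or_eq (G.lvl v) with hx | hx
      · exact hSL _ _ huw (Or.inr hx)
      · exact hadd (Or.inr (heq hx))

/-- the dynamic-programming recurrence: for `s ≠ (0, …, 0)` and a set
`U` of edges joining pairs of vertices on `s`, `T(s, U)` holds iff `T(s_j', U_j')`
holds for some `j ∈ [h]` with `p_j ≥ 1`. -/
theorem dp_recurrence (G : OrderedLevelGraph V) (s : ℕ → ℕ) (hs : IsSep G s)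
    (hnz : ∃ i, s i ≠ 0) (U : Finset (V × V))
    (hU : ∀ e ∈ U, G.Edge e.1 e.2 ∧ OnSep G s e.1 ∧ OnSep G s e.2) :
    T G s (some U) ↔
      ∃ j, 1 ≤ j ∧ j ≤ G.h ∧ 1 ≤ s j ∧ T G (sj s j) (Uj G s U j) := by
  constructor
  · intro h
    obtain ⟨S, hS, hSU, hSL⟩ := (T_some_iff _ _ _).1 h
    obtain ⟨j, S', hj, hS', rfl⟩ := hS.exists_prev hnz
    obtain ⟨v, rfl, hv⟩ := hs.exists_vertex hj
    refine ⟨G.lvl v, G.lvl_one_le v, G.lvl_le v, hj, ?_⟩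
    rcases hv with hv | hv
    · exact T_sj_of_vertex hv hS' hSU hSL
    · exact T_sj_of_gap hv hS' hSU hSL
  · rintro ⟨j, -, -, hj, h⟩
    obtain ⟨v, rfl, hv⟩ := hs.exists_vertex hj
    rcases hv with hv | hv
    · exact T_of_sj_vertex hs hU hv h
    · exact T_of_sj_gap hs hU hv h
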